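/- arXiv:2206.07875 — 2 statements merged into one kernel-verified Lean document; each statement's English description precedes it below -/
import Mathlib

section
/- Consider the aggregated iteration with D nonexpansive with respect to ‖·‖_H, α, μ ∈ (0,1), ℓ convex and differentiable with L-Lipschitz gradient and bounded below, U ⊆ ℝⁿ nonempty convex and compact, step parameter s ∈ (0, λ_min(H)/L), and suppose the set Ŝ := {u ∈ Fix(T) ∩ U : ℓ(u) = ℓ*} is nonempty, where ℓ* := inf{ℓ(u) : u ∈ Fix(T) ∩ U}. Then the iterates satisfy lim_{k→∞} dist(u^k, Ŝ) = 0 and lim_{k→∞} ℓ(u^k) = ℓ*. -/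
open scoped RealInnerProductSpace
open Filter Topology

/-- The `H`-inner product `⟨u, v⟩_H = uᵀ H v` on `ℝⁿ`. -/
noncomputable def hIP {n : ℕ} (H : Matrix (Fin n) (Fin n) ℝ)
    (u v : EuclideanSpace ℝ (Fin n)) : ℝ :=
  ⟪u, Matrix.toEuclideanLin H v⟫

/-- The `H`-norm `‖u‖_H = √(uᵀ H u)` on `ℝⁿ`. -/
noncomputable def hNorm {n : ℕ} (H : Matrix (Fin n) (Fin n) ℝ)
    (u : EuclideanSpace ℝ (Fin n)) : ℝ :=
  Real.sqrt (hIP H u u)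

/-- The smallest eigenvalue `λ_min(H)` of a Hermitian matrix `H`. -/
noncomputable def lambdaMin {n : ℕ} (H : Matrix (Fin n) (Fin n) ℝ)
    (hH : H.IsHermitian) : ℝ :=
  ⨅ i, hH.eigenvalues i

section helpers
variable {n : ℕ} {H : Matrix (Fin n) (Fin n) ℝ}

lemma hIP_add_left (a b c : EuclideanSpace ℝ (Fin n)) :
    hIP H (a + b) c = hIP H a c + hIP H b c := by
  simp [hIP, inner_add_left]

lemma hIP_add_right (a b c : EuclideanSpace ℝ (Fin n)) :
    hIP H a (b + c) = hIP H a b + hIP H a c := by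
  simp only [hIP, map_add, inner_add_right]

lemma hIP_sub_left (a b c : EuclideanSpace ℝ (Fin n)) :
    hIP H (a - b) c = hIP H a c - hIP H b c := by
  simp [hIP, inner_sub_left]

lemma hIP_sub_right (a b c : EuclideanSpace ℝ (Fin n)) :
    hIP H a (b - c) = hIP H a b - hIP H a c := by
  simp only [hIP, map_sub, inner_sub_right]

lemma hIP_smul_left (r : ℝ) (a c : EuclideanSpace ℝ (Fin n)) :
    hIP H (r • a) c = r * hIP H a c := by
  simp only [hIP, real_inner_smul_left]

lemma hIP_smul_right (r : ℝ) (a c : EuclideanSpace ℝ (Fin n)) :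
    hIP H a (r • c) = r * hIP H a c := by
  simp only [hIP, map_smul, real_inner_smul_right]

lemma hIP_eq (a b : EuclideanSpace ℝ (Fin n)) :
    hIP H a b = a.ofLp ⬝ᵥ (H.mulVec b.ofLp) := by
  simp [hIP, EuclideanSpace.inner_eq_star_dotProduct, dotProduct_comm]

lemma hIP_comm (hH : H.PosDef) (a b : EuclideanSpace ℝ (Fin n)) :
    hIP H a b = hIP H b a := by
  rw [hIP_eq, hIP_eq]
  have h : H.transpose = H := by
    have := hH.1.eq
    rwa [Matrix.conjTranspose_eq_transpose_of_trivial] at this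
  rw [dotProduct_comm, ← Matrix.vecMul_transpose, h, Matrix.dotProduct_mulVec]

lemma hIP_pos (hH : H.PosDef) {a : EuclideanSpace ℝ (Fin n)} (ha : a ≠ 0) :
    0 < hIP H a a := by
  rw [hIP_eq]
  have := hH.dotProduct_mulVec_pos (x := a.ofLp) (by simpa using ha)
  simpa using this

lemma hIP_nonneg (hH : H.PosDef) (a : EuclideanSpace ℝ (Fin n)) :
    0 ≤ hIP H a a := by
  by_cases h : a = 0
  · simp [h, hIP]
  · exact (hIP_pos hH h).le

lemma hIP_inv (hH : H.PosDef) (a g : EuclideanSpace ℝ (Fin n)) :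
    hIP H a (Matrix.toEuclideanLin H⁻¹ g) = ⟪a, g⟫ := by
  have hu : IsUnit H.det := hH.det_pos.ne'.isUnit
  rw [hIP]
  congr 1
  ext i
  simp [Matrix.mulVec_mulVec, Matrix.mul_nonsing_inv _ hu]

lemma hIP_cont : Continuous (fun a : EuclideanSpace ℝ (Fin n) => hIP H a a) := by
  unfold hIP
  exact continuous_id.inner (LinearMap.continuous_of_finiteDimensional _)

lemma hIP_lower (hH : H.PosDef) :
    ∃ m > 0, ∀ a : EuclideanSpace ℝ (Fin n), m * ‖a‖ ^ 2 ≤ hIP H a a := by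
  by_cases hne : (Metric.sphere (0 : EuclideanSpace ℝ (Fin n)) 1).Nonempty
  · obtain ⟨x, hx, hmin⟩ := (isCompact_sphere (0 : EuclideanSpace ℝ (Fin n)) 1).exists_isMinOn
      hne (hIP_cont (H := H)).continuousOn
    have hx0 : x ≠ 0 := by
      rintro rfl
      simp at hx
    refine ⟨hIP H x x, hIP_pos hH hx0, fun a => ?_⟩
    by_cases ha : a = 0
    · simp [ha, hIP]
    have hn : 0 < ‖a‖ := norm_pos_iff.2 ha
    have h1 : (‖a‖⁻¹ • a) ∈ Metric.sphere (0 : EuclideanSpace ℝ (Fin n)) 1 := by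
      simp [norm_smul, hn.ne']
    have h2 := hmin h1
    simp only [Set.mem_ofPred_eq, hIP_smul_left, hIP_smul_right] at h2
    calc hIP H x x * ‖a‖ ^ 2 ≤ (‖a‖⁻¹ * (‖a‖⁻¹ * hIP H a a)) * ‖a‖ ^ 2 := by gcongr
      _ = hIP H a a := by field_simp
  · refine ⟨1, one_pos, fun a => ?_⟩
    by_cases ha : a = 0
    · simp [ha, hIP]
    exfalso
    exact hne ⟨‖a‖⁻¹ • a, by simp [norm_smul, ha]⟩

lemma hNorm_le (hH : H.PosDef) {a b : EuclideanSpace ℝ (Fin n)}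
    (h : hNorm H a ≤ hNorm H b) : hIP H a a ≤ hIP H b b :=
  (Real.sqrt_le_sqrt_iff (hIP_nonneg hH b)).1 h

lemma cont_of_nonexp (hH : H.PosDef) {D : EuclideanSpace ℝ (Fin n) → EuclideanSpace ℝ (Fin n)}
    (hD : ∀ u₁ u₂, hNorm H (D u₁ - D u₂) ≤ hNorm H (u₁ - u₂)) : Continuous D := by
  obtain ⟨m, hm, hlow⟩ := hIP_lower hH
  rw [continuous_iff_continuousAt]
  intro x
  rw [ContinuousAt, tendsto_iff_norm_sub_tendsto_zero]
  have h1 : Tendsto (fun y => Real.sqrt (hIP H (y - x) (y - x) / m)) (𝓝 x) (𝓝 0) := by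
    have : Continuous (fun y => Real.sqrt (hIP H (y - x) (y - x) / m)) :=
      (((hIP_cont (H := H)).comp (continuous_id.sub continuous_const)).div_const m).sqrt
    have h := this.tendsto x
    simpa [hIP] using h
  refine squeeze_zero (fun _ => norm_nonneg _) (fun y => ?_) h1
  apply Real.le_sqrt_of_sq_le
  rw [le_div_iff₀ hm]
  have := hlow (D y - D x)
  have := hNorm_le hH (hD y x)
  linarith

lemma proj_ineq (hH : H.PosDef) {U : Set (EuclideanSpace ℝ (Fin n))} (hU : Convex ℝ U)
    {x z p : EuclideanSpace ℝ (Fin n)} (hx : x ∈ U) (hp : p ∈ U)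
    (h : ∀ w ∈ U, hNorm H (x - z) ≤ hNorm H (w - z)) :
    hIP H (x - p) (x - p) ≤ hIP H (z - p) (z - p) := by
  have key : 0 ≤ hIP H (x - z) (p - x) := by
    by_contra hneg
    push Not at hneg
    set c := hIP H (x - z) (p - x) with hc
    set q := hIP H (p - x) (p - x) with hq
    have hq0 : 0 ≤ q := hIP_nonneg hH _
    have hall : ∀ τ : ℝ, 0 < τ → τ ≤ 1 → 0 ≤ 2 * c + τ * q := by
      intro τ h0 h1
      have hw : x + τ • (p - x) ∈ U := hU.add_smul_sub_mem hx hp ⟨h0.le, h1⟩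
      have h2 := hNorm_le hH (h _ hw)
      have e : x + τ • (p - x) - z = (x - z) + τ • (p - x) := by abel
      rw [e, hIP_add_left, hIP_add_right, hIP_add_right, hIP_smul_left, hIP_smul_left,
        hIP_smul_right, hIP_smul_right, hIP_comm hH (p - x) (x - z), ← hc, ← hq] at h2
      have : 0 ≤ τ * (2 * c + τ * q) := by linarith
      exact nonneg_of_mul_nonneg_right this h0
    have hτ := hall (min 1 (-c / (q + 1))) (lt_min one_pos (by apply div_pos <;> linarith))
      (min_le_left _ _)
    have : min 1 (-c / (q + 1)) * q ≤ -c := by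
      calc min 1 (-c / (q + 1)) * q ≤ (-c / (q + 1)) * (q + 1) := by
            apply mul_le_mul (min_le_right _ _) (by linarith) hq0
            apply div_nonneg <;> linarith
        _ = -c := by field_simp
    linarith
  have e : z - p = (x - p) - (x - z) := by abel
  have h3 := hIP_nonneg hH (x - z)
  rw [e, hIP_sub_left (x - p) (x - z), hIP_sub_right (x - p) (x - p) (x - z),
    hIP_sub_right (x - z) (x - p) (x - z), hIP_comm hH (x - p) (x - z)]
  have h4 : hIP H (x - z) (p - x) = - hIP H (x - z) (x - p) := by
    simp only [hIP_sub_right]; ring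
  linarith

lemma convex_grad {ℓ : EuclideanSpace ℝ (Fin n) → ℝ}
    (hconv : ConvexOn ℝ Set.univ ℓ) (hdiff : Differentiable ℝ ℓ) (x p : EuclideanSpace ℝ (Fin n)) :
    ℓ x - ℓ p ≤ ⟪x - p, gradient ℓ x⟫ := by
  have h1 : HasDerivAt (fun τ : ℝ => ℓ (x + τ • (p - x))) ⟪gradient ℓ x, p - x⟫ 0 := by
    have hg : HasFDerivAt ℓ (InnerProductSpace.toDual ℝ _ (gradient ℓ x)) (x + (0 : ℝ) • (p - x)) := by
      simpa using (hdiff x).hasGradientAt.hasFDerivAt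
    have hl : HasDerivAt (fun τ : ℝ => x + τ • (p - x)) (p - x) 0 := by
      simpa using ((hasDerivAt_id (0 : ℝ)).smul_const (p - x)).const_add x
    exact hg.comp_hasDerivAt (0 : ℝ) hl
  have h2 : ConvexOn ℝ Set.univ (fun τ : ℝ => ℓ (x + τ • (p - x))) := by
    have := hconv.comp_affineMap (AffineMap.lineMap x p)
    have e : (fun τ : ℝ => ℓ (x + τ • (p - x))) = ℓ ∘ (AffineMap.lineMap x p : ℝ →ᵃ[ℝ] _) := by
      ext τ
      simp [AffineMap.lineMap_apply, add_comm]
    rw [e]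
    exact this
  have h3 := h2.le_slope_of_hasDerivAt (Set.mem_univ 0) (Set.mem_univ 1) one_pos h1
  simp only [slope_def_field, one_smul, zero_smul, add_zero, sub_zero, div_one,
    add_sub_cancel] at h3
  have h4 : ⟪x - p, gradient ℓ x⟫ = - ⟪gradient ℓ x, p - x⟫ := by
    rw [real_inner_comm, ← inner_neg_right, neg_sub]
  linarith

lemma key_ineq (hH : H.PosDef) {e f g : EuclideanSpace ℝ (Fin n)} {α μ t : ℝ}
    (hα : α ∈ Set.Ioo (0 : ℝ) 1) (hμ : μ ∈ Set.Ioo (0 : ℝ) 1)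
    (hf : hIP H f f ≤ hIP H e e) :
    hIP H (μ • (e - t • g) + (1 - μ) • ((1 - α) • e + α • f))
      (μ • (e - t • g) + (1 - μ) • ((1 - α) • e + α • f)) ≤
    hIP H e e - 2 * μ * t * hIP H e g + μ * t ^ 2 * hIP H g g
      - (1 - μ) * (α * (1 - α)) * hIP H (e - f) (e - f) := by
  obtain ⟨a0, a1⟩ := hα
  obtain ⟨m0, m1⟩ := hμ
  have conv : ∀ (r : ℝ) (a b : EuclideanSpace ℝ (Fin n)),
      hIP H (r • a + (1 - r) • b) (r • a + (1 - r) • b) =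
      r * hIP H a a + (1 - r) * hIP H b b - r * (1 - r) * hIP H (a - b) (a - b) := by
    intro r a b
    simp only [hIP_add_left, hIP_add_right, hIP_sub_left, hIP_sub_right, hIP_smul_left,
      hIP_smul_right, hIP_comm hH b a]
    ring
  have h1 := conv μ (e - t • g) ((1 - α) • e + α • f)
  have h2 := conv (1 - α) e f
  rw [sub_sub_cancel] at h2
  have h3 : hIP H (e - t • g) (e - t • g) = hIP H e e - 2 * t * hIP H e g + t ^ 2 * hIP H g g := by
    simp only [hIP_sub_left, hIP_sub_right, hIP_smul_left, hIP_smul_right, hIP_comm hH g e]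
    ring
  have h4 : 0 ≤ μ * (1 - μ) * hIP H (e - t • g - ((1 - α) • e + α • f))
      (e - t • g - ((1 - α) • e + α • f)) :=
    mul_nonneg (mul_nonneg m0.le (by linarith)) (hIP_nonneg hH _)
  rw [h1, h2, h3]
  have h5 : 0 ≤ (1 - μ) * α * (hIP H e e - hIP H f f) :=
    mul_nonneg (mul_nonneg (by linarith) a0.le) (by linarith)
  nlinarith

end helpers

lemma seq_lemma {d t B : ℕ → ℝ} (hd : ∀ k, 0 ≤ d k) (ht : ∀ k, 0 ≤ t k)
    (hsum : Tendsto (fun N => ∑ i ∈ Finset.range N, t i) atTop atTop)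
    (hB : Tendsto B atTop (𝓝 0))
    (hstep : ∀ k, d (k + 1) ≤ d k + B k)
    (hdec : ∀ ε > 0, ∃ δ > 0, ∀ᶠ k in atTop, ε ≤ d k → d (k + 1) ≤ d k - δ * t k) :
    Tendsto d atTop (𝓝 0) := by
  have main : ∀ ε > 0, ∀ᶠ k in atTop, d k ≤ 2 * ε := by
    intro ε hε
    obtain ⟨δ, hδ, hev⟩ := hdec ε hε
    have hBe : ∀ᶠ k in atTop, B k < ε := hB.eventually_lt_const hε
    obtain ⟨N, hN⟩ := eventually_atTop.1 (hev.and hBe)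
    have hex : ∃ k ≥ N, d k < ε := by
      by_contra hcon
      push Not at hcon
      have hb : ∀ j, d (N + j) + δ * ∑ i ∈ Finset.range (N + j), t i ≤
          d N + δ * ∑ i ∈ Finset.range N, t i := by
        intro j
        induction j with
        | zero => simp
        | succ j ih =>
          have := (hN (N + j) (by omega)).1 (hcon _ (by omega))
          rw [← add_assoc, Finset.sum_range_succ, mul_add]
          linarith
      have hu := (tendsto_atTop.1 hsum ((d N + δ * ∑ i ∈ Finset.range N, t i) / δ + 1))
      obtain ⟨M, hM⟩ := eventually_atTop.1 hu
      have h1 := hM (N + M) (by omega)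
      have h2 := hb M
      have h3 := hd (N + M)
      have h4 : δ * ((d N + δ * ∑ i ∈ Finset.range N, t i) / δ + 1) ≤
        δ * ∑ i ∈ Finset.range (N + M), t i := by gcongr
      have h5 : δ * ((d N + δ * ∑ i ∈ Finset.range N, t i) / δ + 1) =
        d N + δ * ∑ i ∈ Finset.range N, t i + δ := by field_simp
      linarith
    obtain ⟨k0, hk0, hlt⟩ := hex
    filter_upwards [eventually_ge_atTop k0] with k hk
    induction k, hk using Nat.le_induction with
    | base => linarith
    | succ k hk ih =>
      obtain ⟨h1, h2⟩ := hN k (by omega)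
      by_cases hc : ε ≤ d k
      · have := h1 hc
        have := mul_nonneg hδ.le (ht k)
        linarith
      · have := hstep k
        linarith
  rw [Metric.tendsto_atTop]
  intro ε hε
  obtain ⟨N, hN⟩ := eventually_atTop.1 (main (ε / 4) (by linarith))
  refine ⟨N, fun k hk => ?_⟩
  rw [Real.dist_eq, sub_zero, abs_of_nonneg (hd k)]
  have := hN k hk
  linarith

/-- the aggregated iteration converges: `dist(u^k, Ŝ) → 0`
and `ℓ(u^k) → ℓ*`, where `ℓ* = inf {ℓ(u) : u ∈ Fix(T) ∩ U}` and
`Ŝ = {u ∈ Fix(T) ∩ U : ℓ(u) = ℓ*}` (assumed nonempty). -/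
theorem stmt_7 {n : ℕ} (H : Matrix (Fin n) (Fin n) ℝ) (hH : H.PosDef)
    (D : EuclideanSpace ℝ (Fin n) → EuclideanSpace ℝ (Fin n))
    (hD : ∀ u₁ u₂, hNorm H (D u₁ - D u₂) ≤ hNorm H (u₁ - u₂))
    (ℓ : EuclideanSpace ℝ (Fin n) → ℝ)
    (hconv : ConvexOn ℝ Set.univ ℓ) (hdiff : Differentiable ℝ ℓ)
    (L : ℝ) (hL : 0 < L)
    (hLip : ∀ u v, ‖gradient ℓ u - gradient ℓ v‖ ≤ L * ‖u - v‖)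
    (hbdd : BddBelow (Set.range ℓ))
    (α μ : ℝ) (hα : α ∈ Set.Ioo (0 : ℝ) 1) (hμ : μ ∈ Set.Ioo (0 : ℝ) 1)
    (s : ℝ) (hs : s ∈ Set.Ioo 0 (lambdaMin H hH.1 / L))
    (U : Set (EuclideanSpace ℝ (Fin n)))
    (hUne : U.Nonempty) (hUcp : IsCompact U) (hUco : Convex ℝ U)
    (T : EuclideanSpace ℝ (Fin n) → EuclideanSpace ℝ (Fin n))
    (hT : ∀ u, T u = (1 - α) • u + α • D u)
    (lstar : ℝ) (hlstar : lstar = sInf (ℓ '' ({y | T y = y} ∩ U)))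
    (Shat : Set (EuclideanSpace ℝ (Fin n)))
    (hShat : Shat = {x | T x = x ∧ x ∈ U ∧ ℓ x = lstar})
    (hShatne : Shat.Nonempty)
    (u vl vu : ℕ → EuclideanSpace ℝ (Fin n))
    (hu0 : u 0 ∈ U)
    (hvl : ∀ k, vl (k + 1) = T (u k))
    (hvu : ∀ k, vu (k + 1) =
      u k - (s / ((k : ℝ) + 1)) • Matrix.toEuclideanLin H⁻¹ (gradient ℓ (u k)))
    (hproj : ∀ k, u (k + 1) ∈ U ∧ ∀ w ∈ U,
      hNorm H (u (k + 1) - (μ • vu (k + 1) + (1 - μ) • vl (k + 1))) ≤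
        hNorm H (w - (μ • vu (k + 1) + (1 - μ) • vl (k + 1)))) :
    Tendsto (fun k => Metric.infDist (u k) Shat) atTop (𝓝 0) ∧
      Tendsto (fun k => ℓ (u k)) atTop (𝓝 lstar) := by
  obtain ⟨m, hm, hlow⟩ := hIP_lower hH
  have hDc : Continuous D := cont_of_nonexp hH hD
  have hlc : Continuous ℓ := hdiff.continuous
  have hgc : Continuous (gradient ℓ) := by
    have : LipschitzWith L.toNNReal (gradient ℓ) := by
      apply LipschitzWith.of_dist_le_mul
      intro x y
      rw [dist_eq_norm, dist_eq_norm, Real.coe_toNNReal _ hL.le]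
      exact hLip x y
    exact this.continuous
  have hfix : ∀ y, T y = y ↔ D y = y := by
    intro y
    have e : T y - y = α • (D y - y) := by rw [hT]; module
    rw [← sub_eq_zero, e, smul_eq_zero, sub_eq_zero]
    simp [hα.1.ne']
  have hlow_star : ∀ x ∈ U, D x = x → lstar ≤ ℓ x := by
    intro x hx hDx
    rw [hlstar]
    apply csInf_le
    · exact hbdd.mono (Set.image_subset_range _ _)
    · exact ⟨x, ⟨(hfix x).2 hDx, hx⟩, rfl⟩
  have hSmem : ∀ x, x ∈ Shat ↔ D x = x ∧ x ∈ U ∧ ℓ x = lstar := by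
    intro x
    rw [hShat, ← hfix]
    rfl
  have hScp : IsCompact Shat := by
    have e : Shat = U ∩ ({x | D x = x} ∩ {x | ℓ x = lstar}) := by
      ext x
      rw [hSmem]
      constructor
      · rintro ⟨a, b, c⟩
        exact ⟨b, a, c⟩
      · rintro ⟨b, a, c⟩
        exact ⟨a, b, c⟩
    rw [e]
    exact hUcp.inter_right
      ((isClosed_eq hDc continuous_id).inter (isClosed_eq hlc continuous_const))
  have huU : ∀ k, u k ∈ U := by
    intro k
    cases k with
    | zero => exact hu0
    | succ k => exact (hproj k).1
  set Hi := Matrix.toEuclideanLin H⁻¹ with hHi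
  have hHic : Continuous Hi := LinearMap.continuous_of_finiteDimensional _
  obtain ⟨G, hG⟩ := hUcp.exists_bound_of_continuousOn
    ((hIP_cont (H := H)).comp (hHic.comp hgc)).continuousOn
  obtain ⟨M, hM⟩ := hUcp.exists_bound_of_continuousOn
    (hlc.sub (continuous_const (y := lstar))).continuousOn
  simp only [Real.norm_eq_abs, Function.comp_apply, Pi.sub_apply] at hG hM
  have hG0 : 0 ≤ G := (abs_nonneg _).trans (hG _ hu0)
  have hM0 : 0 ≤ M := (abs_nonneg _).trans (hM _ hu0)
  have hmin : ∀ k, ∃ p ∈ Shat, ∀ q ∈ Shat, hIP H (u k - p) (u k - p) ≤ hIP H (u k - q) (u k - q) := by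
    intro k
    obtain ⟨p, hp, hpm⟩ := hScp.exists_isMinOn hShatne
      ((hIP_cont (H := H)).comp (continuous_const.sub continuous_id : Continuous fun q => u k - q)).continuousOn
    exact ⟨p, hp, fun q hq => hpm hq⟩
  choose p hpS hpmin using hmin
  set d : ℕ → ℝ := fun k => hIP H (u k - p k) (u k - p k) with hd
  set t : ℕ → ℝ := fun k => s / ((k : ℝ) + 1) with ht
  set c : ℝ := (1 - μ) * (α * (1 - α)) with hc
  have hs0 := hs.1
  have hμ0 := hμ.1
  have hc0 : 0 < c := by
    have h1 := hμ.2
    have h2 := hα.1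
    have h3 := hα.2
    exact mul_pos (by linarith) (mul_pos h2 (by linarith))
  have htpos : ∀ k, 0 < t k := fun k => by simp only [ht]; positivity
  have hmain : ∀ k, d (k + 1) ≤ d k - 2 * μ * t k * (ℓ (u k) - lstar) + μ * t k ^ 2 * G
      - c * hIP H (u k - D (u k)) (u k - D (u k)) := by
    intro k
    obtain ⟨hpD, hpU, hpl⟩ := (hSmem _).1 (hpS k)
    have h1 : d (k + 1) ≤ hIP H (u (k + 1) - p k) (u (k + 1) - p k) := hpmin (k + 1) _ (hpS k)
    have h2 := proj_ineq hH hUco (hproj k).1 hpU (hproj k).2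
    have e : μ • vu (k + 1) + (1 - μ) • vl (k + 1) - p k =
        μ • ((u k - p k) - t k • Hi (gradient ℓ (u k))) +
          (1 - μ) • ((1 - α) • (u k - p k) + α • (D (u k) - p k)) := by
      rw [hvu, hvl, hT]
      module
    have hf : hIP H (D (u k) - p k) (D (u k) - p k) ≤ hIP H (u k - p k) (u k - p k) := by
      have := hNorm_le hH (hD (u k) (p k))
      rwa [hpD] at this
    have h3 := key_ineq (g := Hi (gradient ℓ (u k))) (t := t k) hH hα hμ hf
    rw [← e, sub_sub_sub_cancel_right, hHi, hIP_inv hH, ← hHi] at h3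
    have h4 := convex_grad hconv hdiff (u k) (p k)
    rw [hpl] at h4
    have h5 : 2 * μ * t k * (ℓ (u k) - lstar) ≤
        2 * μ * t k * ⟪u k - p k, gradient ℓ (u k)⟫ := by
      have := htpos k
      gcongr
    have h6 : μ * t k ^ 2 * hIP H (Hi (gradient ℓ (u k))) (Hi (gradient ℓ (u k))) ≤
        μ * t k ^ 2 * G := by
      have := (le_abs_self _).trans (hG _ (huU k))
      gcongr
    have h7 : d k = hIP H (u k - p k) (u k - p k) := rfl
    linarith
  have htlim : Tendsto t atTop (𝓝 0) := by
    have := (tendsto_one_div_add_atTop_nhds_zero_nat (𝕜 := ℝ)).const_mul s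
    simpa [ht, div_eq_mul_inv] using this
  have htsum : Tendsto (fun N => ∑ i ∈ Finset.range N, t i) atTop atTop := by
    have := (Real.tendsto_sum_range_one_div_nat_succ_atTop).const_mul_atTop hs0
    refine this.congr fun N => ?_
    rw [Finset.mul_sum]
    simp [ht, div_eq_mul_inv]
  have hBlim : Tendsto (fun k => 2 * μ * t k * M + μ * t k ^ 2 * G) atTop (𝓝 0) := by
    have := ((htlim.const_mul (2 * μ)).mul_const M).add (((htlim.pow 2).const_mul μ).mul_const G)
    simpa using this
  have hd0 : ∀ k, 0 ≤ d k := fun k => hIP_nonneg hH _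
  have hQD : ∀ k, 0 ≤ hIP H (u k - D (u k)) (u k - D (u k)) := fun k => hIP_nonneg hH _
  have hlM : ∀ k, -(2 * μ * t k * M) ≤ 2 * μ * t k * (ℓ (u k) - lstar) := by
    intro k
    have h1 := (abs_le.1 (hM _ (huU k))).1
    have h2 : 0 ≤ 2 * μ * t k := by have := htpos k; positivity
    nlinarith
  have hdlim : Tendsto d atTop (𝓝 0) := by
    refine seq_lemma hd0 (fun k => (htpos k).le) htsum hBlim ?_ ?_
    · intro k
      have h1 := hmain k
      have h2 := hlM k
      have h3 := mul_nonneg hc0.le (hQD k)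
      linarith
    · intro ε hε
      set K : Set (EuclideanSpace ℝ (Fin n)) :=
        U ∩ ⋂ q ∈ Shat, {x | ε ≤ hIP H (x - q) (x - q)} with hK
      have hKc : IsCompact K := by
        apply hUcp.inter_right
        refine isClosed_biInter fun q _ => ?_
        exact isClosed_le continuous_const
          ((hIP_cont (H := H)).comp (continuous_id.sub continuous_const))
      have hδ : ∃ δ > 0, ∀ x ∈ K, δ ≤ max (ℓ x - lstar) (hIP H (x - D x) (x - D x)) := by
        by_cases hKne : K.Nonempty
        · obtain ⟨x, hx, hxm⟩ := hKc.exists_isMinOn hKne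
            ((hlc.sub (continuous_const (y := lstar))).max
              ((hIP_cont (H := H)).comp (continuous_id.sub hDc))).continuousOn
          refine ⟨max (ℓ x - lstar) (hIP H (x - D x) (x - D x)), ?_, fun y hy => hxm hy⟩
          by_contra hneg
          rw [gt_iff_lt, not_lt, max_le_iff] at hneg
          have hDx : D x = x := by
            by_contra hne
            have := hIP_pos hH (sub_ne_zero.2 (Ne.symm hne))
            linarith
          have hl := hlow_star x hx.1 hDx
          have hxS : x ∈ Shat := (hSmem x).2 ⟨hDx, hx.1, by linarith⟩
          have h0 : ε ≤ hIP H (x - x) (x - x) := Set.mem_iInter₂.1 hx.2 x hxS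
          simp [hIP] at h0
          linarith
        · exact ⟨1, one_pos, fun x hx => absurd ⟨x, hx⟩ hKne⟩
      obtain ⟨δ, hδ0, hδK⟩ := hδ
      refine ⟨μ * δ, by positivity, ?_⟩
      have ev1 : ∀ᶠ k in atTop, t k * G < δ := by
        have := htlim.mul_const G
        rw [zero_mul] at this
        exact this.eventually_lt_const hδ0
      have ev2 : ∀ᶠ k in atTop, 2 * μ * t k * M + μ * t k ^ 2 * G + μ * δ * t k < c * δ := by
        have := hBlim.add (htlim.const_mul (μ * δ))
        rw [mul_zero, zero_add] at this
        exact this.eventually_lt_const (by positivity)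
      filter_upwards [ev1, ev2] with k h1 h2 hεk
      have hkK : u k ∈ K := by
        refine ⟨huU k, Set.mem_iInter₂.2 fun q hq => ?_⟩
        exact hεk.trans (hpmin k q hq)
      have h3 := hmain k
      have htk := htpos k
      rcases le_max_iff.1 (hδK _ hkK) with h4 | h4
      · have h5 := mul_nonneg hc0.le (hQD k)
        have h6 : 2 * μ * t k * δ ≤ 2 * μ * t k * (ℓ (u k) - lstar) := by gcongr
        have h7 : μ * t k * (t k * G) ≤ μ * t k * δ := by gcongr
        linarith
      · have h5 := hlM k
        have h6 : c * δ ≤ c * hIP H (u k - D (u k)) (u k - D (u k)) := by gcongr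
        linarith
  have hnorm : Tendsto (fun k => dist (u k) (p k)) atTop (𝓝 0) := by
    have h1 : Tendsto (fun k => Real.sqrt (d k / m)) atTop (𝓝 0) := by
      have := (hdlim.div_const m).sqrt
      simpa using this
    refine squeeze_zero (fun _ => dist_nonneg) (fun k => ?_) h1
    rw [dist_eq_norm]
    apply Real.le_sqrt_of_sq_le
    rw [le_div_iff₀ hm, mul_comm]
    exact hlow _
  constructor
  · exact squeeze_zero (fun _ => Metric.infDist_nonneg)
      (fun k => Metric.infDist_le_dist_of_mem (hpS k)) hnorm
  · have huc := hUcp.uniformContinuousOn_of_continuous hlc.continuousOn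
    rw [Metric.uniformContinuousOn_iff] at huc
    rw [Metric.tendsto_atTop]
    intro ε hε
    obtain ⟨η, hη, hηU⟩ := huc ε hε
    obtain ⟨N, hN⟩ := eventually_atTop.1 (hnorm.eventually_lt_const hη)
    refine ⟨N, fun k hk => ?_⟩
    obtain ⟨_, hpU, hpl⟩ := (hSmem _).1 (hpS k)
    have := hηU _ (huU k) _ hpU (hN k hk)
    rwa [hpl] at this
end

section
/- Consider the aggregated iteration with D nonexpansive with respect to ‖·‖_H, α, μ ∈ (0,1), ℓ convex and differentiable with L-Lipschitz gradient and bounded below by M₀, U ⊆ ℝⁿ nonempty convex and compact, s ∈ (0, λ_min(H)/L), and Fix(T) ∩ U nonempty. Let ℓ* := inf{ℓ(u) : u ∈ Fix(T) ∩ U}, D_U := sup{‖u − u'‖_H : u, u' ∈ U}, M := sup{‖∇ℓ(u)‖ : u ∈ U}, and C₁ := (3·(D_U² + 2μs(ℓ* − M₀)) + 2μsD_U·M/λ_min(H)) / min{1 − sL/λ_min(H), (1−α)/α, 1}. Then for all n ≥ 1: ‖u^n − u^{n−1}‖²_H ≤ C₁·(1 + ln n)/n. -/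
open scoped RealInnerProductSpace
open Filter Topology

section abstractPart
variable {V : Type*} [NormedAddCommGroup V] [InnerProductSpace ℝ V]

theorem aux_strong (ℓ : V → ℝ) (g : V → V) (L : ℝ) (hL : 0 < L)
    (h1 : ∀ x y, ℓ x + ⟪g x, y - x⟫ ≤ ℓ y)
    (h2 : ∀ x y, ℓ y ≤ ℓ x + ⟪g x, y - x⟫ + L / 2 * ‖y - x‖ ^ 2) (x y : V) :
    ℓ x + ⟪g x, y - x⟫ + 1 / (2 * L) * ‖g x - g y‖ ^ 2 ≤ ℓ y := by
  have a := h1 x (y - (1 / L) • (g y - g x))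
  have b := h2 y (y - (1 / L) • (g y - g x))
  have e1 : y - (1 / L) • (g y - g x) - x = (y - x) - (1 / L) • (g y - g x) := by abel
  have e2 : y - (1 / L) • (g y - g x) - y = - ((1 / L) • (g y - g x)) := by abel
  rw [e1, inner_sub_right, inner_smul_right] at a
  rw [e2, inner_neg_right, inner_smul_right, norm_neg, norm_smul, mul_pow, Real.norm_eq_abs, sq_abs] at b
  have e3 : ⟪g y, g y - g x⟫ - ⟪g x, g y - g x⟫ = ‖g x - g y‖ ^ 2 := by
    rw [← inner_sub_left, real_inner_self_eq_norm_sq, norm_sub_rev]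
  rw [norm_sub_rev (g y)] at b
  have e4 : L / 2 * ((1 / L) ^ 2 * ‖g x - g y‖ ^ 2) = 1 / (2 * L) * ‖g x - g y‖ ^ 2 := by
    field_simp
  have e5 : 1 / L * ⟪g y, g y - g x⟫ - 1 / L * ⟪g x, g y - g x⟫
      = 2 * (1 / (2 * L) * ‖g x - g y‖ ^ 2) := by
    rw [← mul_sub, e3]; field_simp
  rw [e4] at b
  linarith

theorem aux_coco (ℓ : V → ℝ) (g : V → V) (L : ℝ) (hL : 0 < L)
    (h1 : ∀ x y, ℓ x + ⟪g x, y - x⟫ ≤ ℓ y)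
    (h2 : ∀ x y, ℓ y ≤ ℓ x + ⟪g x, y - x⟫ + L / 2 * ‖y - x‖ ^ 2) (x y : V) :
    ‖g x - g y‖ ^ 2 ≤ L * ⟪g x - g y, x - y⟫ := by
  have a := aux_strong ℓ g L hL h1 h2 x y
  have b := aux_strong ℓ g L hL h1 h2 y x
  rw [norm_sub_rev (g y)] at b
  have e : ⟪g x - g y, x - y⟫ = - ⟪g x, y - x⟫ - ⟪g y, x - y⟫ := by
    rw [inner_sub_left, ← inner_neg_right, neg_sub]
  have : 1 / L * ‖g x - g y‖ ^ 2 ≤ ⟪g x - g y, x - y⟫ := by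
    have : 1 / L * ‖g x - g y‖ ^ 2 = 2 * (1 / (2 * L) * ‖g x - g y‖ ^ 2) := by field_simp
    rw [e, this]; linarith
  calc ‖g x - g y‖ ^ 2 = L * (1 / L * ‖g x - g y‖ ^ 2) := by field_simp
    _ ≤ _ := by gcongr

theorem aux_lip (ℓ : V → ℝ) (g : V → V) (L : ℝ) (hL : 0 < L)
    (h1 : ∀ x y, ℓ x + ⟪g x, y - x⟫ ≤ ℓ y)
    (h2 : ∀ x y, ℓ y ≤ ℓ x + ⟪g x, y - x⟫ + L / 2 * ‖y - x‖ ^ 2) (x y : V) :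
    ‖g x - g y‖ ≤ L * ‖x - y‖ := by
  have a := aux_coco ℓ g L hL h1 h2 x y
  have b := real_inner_le_norm (g x - g y) (x - y)
  rcases (norm_nonneg (g x - g y)).eq_or_lt with h | h
  · rw [← h]; positivity
  · have : ‖g x - g y‖ * ‖g x - g y‖ ≤ ‖g x - g y‖ * (L * ‖x - y‖) := by nlinarith
    exact le_of_mul_le_mul_left this h

theorem aux_low (ℓ : V → ℝ) (g : V → V) (L : ℝ) (hL : 0 < L)
    (h2 : ∀ x y, ℓ y ≤ ℓ x + ⟪g x, y - x⟫ + L / 2 * ‖y - x‖ ^ 2)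
    (M₀ : ℝ) (hM : ∀ x, M₀ ≤ ℓ x) (x : V) :
    ‖g x‖ ^ 2 ≤ 2 * L * (ℓ x - M₀) := by
  have b := h2 x (x - (1 / L) • g x)
  have c := hM (x - (1 / L) • g x)
  have e2 : x - (1 / L) • g x - x = - ((1 / L) • g x) := by abel
  rw [e2, inner_neg_right, inner_smul_right, norm_neg, norm_smul, mul_pow, Real.norm_eq_abs, sq_abs,
    real_inner_self_eq_norm_sq] at b
  have e4 : -(1 / L * ‖g x‖ ^ 2) + L / 2 * ((1 / L) ^ 2 * ‖g x‖ ^ 2) = - (1 / (2 * L) * ‖g x‖ ^ 2) := by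
    field_simp; ring
  have : 1 / (2 * L) * ‖g x‖ ^ 2 ≤ ℓ x - M₀ := by linarith
  calc ‖g x‖ ^ 2 = 2 * L * (1 / (2 * L) * ‖g x‖ ^ 2) := by field_simp
    _ ≤ _ := by gcongr

theorem aux_nonexp (ℓ : V → ℝ) (g : V → V) (L : ℝ) (hL : 0 < L)
    (h1 : ∀ x y, ℓ x + ⟪g x, y - x⟫ ≤ ℓ y)
    (h2 : ∀ x y, ℓ y ≤ ℓ x + ⟪g x, y - x⟫ + L / 2 * ‖y - x‖ ^ 2)
    (t : ℝ) (ht : 0 ≤ t) (htL : t * L ≤ 1) (x y : V) :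
    ‖(x - t • g x) - (y - t • g y)‖ ≤ ‖x - y‖ := by
  have a := aux_coco ℓ g L hL h1 h2 x y
  have e : (x - t • g x) - (y - t • g y) = (x - y) - t • (g x - g y) := by
    rw [smul_sub]; abel
  rw [e]
  refine le_of_sq_le_sq ?_ (norm_nonneg _)
  rw [norm_sub_sq_real, inner_smul_right, norm_smul, mul_pow, Real.norm_eq_abs, sq_abs,
    real_inner_comm]
  have h0 : 0 ≤ ⟪g x - g y, x - y⟫ := by
    have : 0 ≤ L * ⟪g x - g y, x - y⟫ := le_trans (by positivity) a
    exact nonneg_of_mul_nonneg_right this hL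
  have : t ^ 2 * ‖g x - g y‖ ^ 2 ≤ t * ⟪g x - g y, x - y⟫ := by
    calc t ^ 2 * ‖g x - g y‖ ^ 2 ≤ t ^ 2 * (L * ⟪g x - g y, x - y⟫) := by gcongr
      _ = (t * L) * (t * ⟪g x - g y, x - y⟫) := by ring
      _ ≤ 1 * (t * ⟪g x - g y, x - y⟫) := by gcongr
      _ = _ := one_mul _
  nlinarith [mul_nonneg ht h0]

theorem aux_grad (ℓ : V → ℝ) (g : V → V) (L : ℝ)
    (h1 : ∀ x y, ℓ x + ⟪g x, y - x⟫ ≤ ℓ y)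
    (h2 : ∀ x y, ℓ y ≤ ℓ x + ⟪g x, y - x⟫ + L / 2 * ‖y - x‖ ^ 2)
    (t : ℝ) (ht : 0 ≤ t) (x y : V) :
    ‖x - t • g x - y‖ ^ 2 ≤ ‖x - y‖ ^ 2 - 2 * t * (ℓ (x - t • g x) - ℓ y)
      - (1 - t * L) * ‖x - t • g x - x‖ ^ 2 := by
  have a := h1 x y
  have b := h2 x (x - t • g x)
  have e1 : x - t • g x - y = (x - y) - t • g x := by abel
  have e2 : x - t • g x - x = - (t • g x) := by abel
  rw [e2, inner_neg_right, inner_smul_right, norm_neg, norm_smul, mul_pow, Real.norm_eq_abs, sq_abs,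
    real_inner_self_eq_norm_sq] at b
  rw [e1, e2, norm_neg, norm_sub_sq_real, inner_smul_right, norm_smul, mul_pow, Real.norm_eq_abs,
    sq_abs, real_inner_comm, ← neg_sub y x, inner_neg_right, norm_neg]
  nlinarith [mul_le_mul_of_nonneg_left a ht, mul_le_mul_of_nonneg_left b ht]

theorem aux_comb (μ : ℝ) (a b : V) :
    ‖μ • a + (1 - μ) • b‖ ^ 2 = μ * ‖a‖ ^ 2 + (1 - μ) * ‖b‖ ^ 2 - μ * (1 - μ) * ‖a - b‖ ^ 2 := by
  rw [norm_add_sq_real, norm_sub_sq_real, inner_smul_left, inner_smul_right, norm_smul, norm_smul,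
    mul_pow, mul_pow, Real.norm_eq_abs, Real.norm_eq_abs, sq_abs, sq_abs]
  simp; ring

theorem aux_avg (D : V → V) (hD : ∀ x y, ‖D x - D y‖ ≤ ‖x - y‖) (T : V → V) (α : ℝ)
    (hα : 0 < α) (hα1 : α < 1) (hT : ∀ x, T x = (1 - α) • x + α • D x) (y : V) (hy : T y = y)
    (x : V) : ‖T x - y‖ ^ 2 ≤ ‖x - y‖ ^ 2 - (1 - α) / α * ‖T x - x‖ ^ 2 := by
  have hDy : D y = y := by
    have h := hT y
    rw [hy] at h
    have : α • (D y - y) = 0 := by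
      calc α • (D y - y) = ((1 - α) • y + α • D y) - y := by module
        _ = 0 := by rw [← h, sub_self]
    rcases smul_eq_zero.1 this with h' | h'
    · exact absurd h' hα.ne'
    · exact sub_eq_zero.1 h'
  have hd := hD x y
  rw [hDy] at hd
  have e1 : T x - y = α • (D x - y) + (1 - α) • (x - y) := by rw [hT]; module
  have e2 : T x - x = α • (D x - x) := by rw [hT]; module
  have e3 : (D x - y) - (x - y) = D x - x := by abel
  rw [e1, aux_comb, e2, e3, norm_smul, mul_pow, Real.norm_eq_abs, sq_abs]
  have : (1 - α) / α * (α ^ 2 * ‖D x - x‖ ^ 2) = α * (1 - α) * ‖D x - x‖ ^ 2 := by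
    field_simp
  rw [this]
  have : ‖D x - y‖ ^ 2 ≤ ‖x - y‖ ^ 2 := by gcongr
  nlinarith

theorem aux_Tnonexp (D : V → V) (hD : ∀ x y, ‖D x - D y‖ ≤ ‖x - y‖) (T : V → V) (α : ℝ)
    (hα : 0 < α) (hα1 : α < 1) (hT : ∀ x, T x = (1 - α) • x + α • D x) (x y : V) :
    ‖T x - T y‖ ≤ ‖x - y‖ := by
  have e : T x - T y = (1 - α) • (x - y) + α • (D x - D y) := by rw [hT, hT]; module
  rw [e]
  calc _ ≤ ‖(1 - α) • (x - y)‖ + ‖α • (D x - D y)‖ := norm_add_le _ _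
    _ = (1 - α) * ‖x - y‖ + α * ‖D x - D y‖ := by
      rw [norm_smul, norm_smul, Real.norm_of_nonneg hα.le, Real.norm_of_nonneg (by linarith)]
    _ ≤ (1 - α) * ‖x - y‖ + α * ‖x - y‖ := by gcongr; exact hD x y
    _ = _ := by ring

theorem aux_proj (U : Set V) (hU : Convex ℝ U) (z p : V) (hp : p ∈ U)
    (h : ∀ w ∈ U, ‖p - z‖ ≤ ‖w - z‖) (w : V) (hw : w ∈ U) : ⟪z - p, w - p⟫ ≤ 0 := by
  refine (norm_eq_iInf_iff_real_inner_le_zero hU hp).1 ?_ w hw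
  have : Nonempty U := ⟨⟨p, hp⟩⟩
  apply le_antisymm
  · refine le_ciInf fun w => ?_
    rw [norm_sub_rev z p, norm_sub_rev z]; exact h w w.2
  · exact ciInf_le (f := fun w : U => ‖z - w‖) ⟨0, by rintro _ ⟨w, rfl⟩; positivity⟩ ⟨p, hp⟩

theorem aux_proj_sq (U : Set V) (hU : Convex ℝ U) (z p : V) (hp : p ∈ U)
    (h : ∀ w ∈ U, ‖p - z‖ ≤ ‖w - z‖) (w : V) (hw : w ∈ U) :
    ‖p - w‖ ^ 2 ≤ ‖z - w‖ ^ 2 := by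
  have a := aux_proj U hU z p hp h w hw
  have e : z - w = (z - p) - (w - p) := by abel
  rw [norm_sub_rev p w, e, norm_sub_sq_real (z - p)]
  nlinarith [sq_nonneg ‖z - p‖]

theorem aux_proj_nonexp (U : Set V) (hU : Convex ℝ U) (z p z' p' : V) (hp : p ∈ U) (hp' : p' ∈ U)
    (h : ∀ w ∈ U, ‖p - z‖ ≤ ‖w - z‖) (h' : ∀ w ∈ U, ‖p' - z'‖ ≤ ‖w - z'‖) :
    ‖p - p'‖ ≤ ‖z - z'‖ := by
  have a := aux_proj U hU z p hp h p' hp'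
  have b := aux_proj U hU z' p' hp' h' p hp
  have e : ⟪z - z', p - p'⟫ = ‖p - p'‖ ^ 2 - ⟪z - p, p' - p⟫ - ⟪z' - p', p - p'⟫ := by
    rw [← real_inner_self_eq_norm_sq, ← neg_sub p p', inner_neg_right, sub_neg_eq_add,
      ← inner_add_left, ← inner_sub_left]
    congr 1; abel
  have c := real_inner_le_norm (z - z') (p - p')
  rcases (norm_nonneg (p - p')).eq_or_lt with h0 | h0
  · rw [← h0]; positivity
  · refine le_of_mul_le_mul_right ?_ h0
    nlinarith

theorem aux_key (c μ s L D γ Δ : ℝ) (hc : 0 ≤ c) (hc1 : c ≤ 1 - s * L) (hμ : 0 < μ) (hμ1 : μ < 1)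
    (hs : 0 < s) (hL : 0 < L) (hD : 0 ≤ D) (hγ : 0 ≤ γ) (h : γ ^ 2 ≤ 2 * L * Δ) :
    c * (μ * s * D * (γ + L * D)) ≤ D ^ 2 + 2 * μ * s * Δ := by
  have hp : 0 < s * L := mul_pos hs hL
  have hΔ : 0 ≤ Δ := by
    have : 0 ≤ 2 * L * Δ := le_trans (sq_nonneg _) h
    exact nonneg_of_mul_nonneg_right this (by positivity)
  have hsΔ : 0 ≤ s * Δ := mul_nonneg hs.le hΔ
  have q : (s * γ) ^ 2 ≤ 2 * (s * Δ) := by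
    calc (s * γ) ^ 2 = s ^ 2 * γ ^ 2 := by ring
      _ ≤ s ^ 2 * (2 * L * Δ) := by gcongr
      _ = (s * L) * (2 * (s * Δ)) := by ring
      _ ≤ 1 * (2 * (s * Δ)) := by
        apply mul_le_mul_of_nonneg_right _ (by positivity); linarith
      _ = _ := one_mul _
  have a1 : D * (s * γ) ≤ D ^ 2 / 2 + s * Δ := by nlinarith [sq_nonneg (D - s * γ)]
  have a2 : c * (s * L) ≤ 1 / 4 := by nlinarith [sq_nonneg (s * L - 1 / 2)]
  have a3 : c * (D * (s * γ)) ≤ D ^ 2 / 2 + s * Δ := by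
    calc c * (D * (s * γ)) ≤ 1 * (D * (s * γ)) := by
          apply mul_le_mul_of_nonneg_right _ (by positivity); linarith
      _ ≤ _ := by linarith
  have a4 : c * (s * L) * D ^ 2 ≤ 1 / 4 * D ^ 2 := by gcongr
  have a5 : μ * (c * (D * (s * γ)) + c * (s * L) * D ^ 2) ≤ μ * (D ^ 2 + s * Δ) := by
    apply mul_le_mul_of_nonneg_left _ hμ.le
    nlinarith [sq_nonneg D]
  have a6 : μ * D ^ 2 ≤ 1 * D ^ 2 := by gcongr
  have a7 : 0 ≤ μ * (s * Δ) := by positivity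
  nlinarith

theorem aux_main (U : Set V) (hU : Convex ℝ U) (D : V → V) (hD : ∀ x y, ‖D x - D y‖ ≤ ‖x - y‖)
    (T : V → V) (α : ℝ) (hα : 0 < α) (hα1 : α < 1) (hT : ∀ x, T x = (1 - α) • x + α • D x)
    (ℓ : V → ℝ) (g : V → V) (L : ℝ) (hL : 0 < L)
    (h1 : ∀ x y, ℓ x + ⟪g x, y - x⟫ ≤ ℓ y)
    (h2 : ∀ x y, ℓ y ≤ ℓ x + ⟪g x, y - x⟫ + L / 2 * ‖y - x‖ ^ 2)
    (M₀ : ℝ) (hM : ∀ x, M₀ ≤ ℓ x) (μ s : ℝ) (hμ : 0 < μ) (hμ1 : μ < 1) (hs : 0 < s)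
    (hsL : s * L < 1) (y : V) (hyU : y ∈ U) (hy : T y = y)
    (DU : ℝ) (hDU : ∀ x ∈ U, ∀ x' ∈ U, ‖x - x'‖ ≤ DU)
    (c : ℝ) (hc : 0 < c) (hc1 : c ≤ 1 - s * L) (hc2 : c ≤ (1 - α) / α)
    (u z : ℕ → V) (hu0 : u 0 ∈ U)
    (hz : ∀ k : ℕ, z k = μ • (u k - (s / ((k : ℝ) + 1)) • g (u k)) + (1 - μ) • T (u k))
    (hproj : ∀ k, u (k + 1) ∈ U ∧ ∀ w ∈ U, ‖u (k + 1) - z k‖ ≤ ‖w - z k‖) (N : ℕ) :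
    c * ((N + 1 : ℝ) * ‖u (N + 1) - u N‖ ^ 2) ≤
      3 * (DU ^ 2 + 2 * μ * s * (ℓ y - M₀)) * (1 + Real.log (N + 1 : ℕ)) := by
  have hDU0 : 0 ≤ DU := le_trans (norm_nonneg _) (hDU y hyU y hyU)
  have huU : ∀ k, u k ∈ U := fun k => by
    cases k with
    | zero => exact hu0
    | succ k => exact (hproj k).1
  have ht0 : ∀ k : ℕ, 0 ≤ s / ((k : ℝ) + 1) := fun k => by positivity
  have hts : ∀ k : ℕ, s / ((k : ℝ) + 1) ≤ s := fun k => by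
    apply div_le_self hs.le
    have : (0 : ℝ) ≤ k := by positivity
    linarith
  have htL : ∀ k : ℕ, s / ((k : ℝ) + 1) * L ≤ s * L := fun k =>
    mul_le_mul_of_nonneg_right (hts k) hL.le
  set Δ := ℓ y - M₀ with hΔ
  have hΔ0 : 0 ≤ Δ := sub_nonneg.2 (hM y)
  set G := ‖g y‖ + L * DU with hG
  have hG0 : 0 ≤ G := by positivity
  have hgG : ∀ k, ‖g (u k)‖ ≤ G := fun k => by
    have a := aux_lip ℓ g L hL h1 h2 (u k) y
    have b : ‖g (u k)‖ ≤ ‖g y‖ + ‖g (u k) - g y‖ := by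
      have := norm_add_le (g y) (g (u k) - g y)
      rwa [add_sub_cancel] at this
    have c' : L * ‖u k - y‖ ≤ L * DU := by gcongr; exact hDU _ (huU k) _ hyU
    linarith
  -- energy
  have energy : ∀ k : ℕ, ‖u (k + 1) - y‖ ^ 2 + c * ‖u (k + 1) - u k‖ ^ 2 ≤
      ‖u k - y‖ ^ 2 + 2 * μ * (s / ((k : ℝ) + 1)) * Δ := fun k => by
    obtain ⟨hp, hpr⟩ := hproj k
    have p1 := aux_proj_sq U hU _ _ hp hpr y hyU
    have p2 := aux_proj_sq U hU _ _ hp hpr (u k) (huU k)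
    have b1 := aux_grad ℓ g L h1 h2 _ (ht0 k) (u k) y
    have b2 := aux_avg D hD T α hα hα1 hT y hy (u k)
    have htLk := htL k
    have htk := ht0 k
    have hzk := hz k
    set t := s / ((k : ℝ) + 1) with htdef
    set v := u k - t • g (u k) with hv
    have hMv := hM v
    have e1 : z k - y = μ • (v - y) + (1 - μ) • (T (u k) - y) := by rw [hzk]; module
    have e2 : z k - u k = μ • (v - u k) + (1 - μ) • (T (u k) - u k) := by rw [hzk]; module
    rw [e1, aux_comb, sub_sub_sub_cancel_right] at p1
    rw [e2, aux_comb, sub_sub_sub_cancel_right] at p2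
    have q0 : 0 ≤ μ * (1 - μ) * ‖v - T (u k)‖ ^ 2 := by
      have : 0 ≤ 1 - μ := by linarith
      positivity
    have q1 : c * ‖v - u k‖ ^ 2 ≤ (1 - t * L) * ‖v - u k‖ ^ 2 := by
      apply mul_le_mul_of_nonneg_right _ (sq_nonneg _); linarith
    have q2 : c * ‖T (u k) - u k‖ ^ 2 ≤ (1 - α) / α * ‖T (u k) - u k‖ ^ 2 := by
      apply mul_le_mul_of_nonneg_right _ (sq_nonneg _); linarith
    have q3 : - (2 * t * (ℓ v - ℓ y)) ≤ 2 * t * Δ := by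
      have : 0 ≤ t * (ℓ v - M₀) := mul_nonneg htk (by linarith)
      rw [hΔ]; linarith
    have r1 : μ * ‖v - y‖ ^ 2 ≤ μ * (‖u k - y‖ ^ 2 + 2 * t * Δ - c * ‖v - u k‖ ^ 2) :=
      mul_le_mul_of_nonneg_left (by linarith) hμ.le
    have r2 : (1 - μ) * ‖T (u k) - y‖ ^ 2 ≤
        (1 - μ) * (‖u k - y‖ ^ 2 - c * ‖T (u k) - u k‖ ^ 2) :=
      mul_le_mul_of_nonneg_left (by linarith) (by linarith)
    have r3 : c * ‖u (k + 1) - u k‖ ^ 2 ≤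
        c * (μ * ‖v - u k‖ ^ 2 + (1 - μ) * ‖T (u k) - u k‖ ^ 2) :=
      mul_le_mul_of_nonneg_left (by linarith) hc.le
    linarith
  -- recursion
  have recur : ∀ k : ℕ, ‖u (k + 2) - u (k + 1)‖ ≤ ‖u (k + 1) - u k‖ +
      μ * (s * G / (((k : ℝ) + 1) * (k + 2))) := fun k => by
    have a := aux_proj_nonexp U hU _ _ _ _ (hproj (k + 1)).1 (hproj k).1 (hproj (k + 1)).2
      (hproj k).2
    have n1 := aux_nonexp ℓ g L hL h1 h2 _ (ht0 (k + 1)) ((htL (k + 1)).trans hsL.le)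
      (u (k + 1)) (u k)
    have n2 := aux_Tnonexp D hD T α hα hα1 hT (u (k + 1)) (u k)
    have e0 : s / ((k : ℝ) + 1) - s / (((k + 1 : ℕ) : ℝ) + 1) =
        s / (((k : ℝ) + 1) * (k + 2)) := by
      push_cast
      have : (k : ℝ) + 1 + 1 = k + 2 := by ring
      rw [this]
      field_simp
      ring
    have hd0 : 0 ≤ s / (((k : ℝ) + 1) * (k + 2)) := by positivity
    have e : z (k + 1) - z k = μ • ((u (k + 1) - (s / (((k + 1 : ℕ) : ℝ) + 1)) • g (u (k + 1))) -
          (u k - (s / (((k + 1 : ℕ) : ℝ) + 1)) • g (u k))) + (1 - μ) • (T (u (k + 1)) - T (u k))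
        + (μ * (s / (((k : ℝ) + 1) * (k + 2)))) • g (u k) := by
      rw [hz, hz, ← e0]; module
    refine a.trans ?_
    rw [e]
    refine (norm_add₃_le).trans ?_
    rw [norm_smul, norm_smul, norm_smul, Real.norm_of_nonneg hμ.le,
      Real.norm_of_nonneg (by linarith : 0 ≤ 1 - μ), Real.norm_of_nonneg (mul_nonneg hμ.le hd0)]
    have m1 := mul_le_mul_of_nonneg_left n1 hμ.le
    have m2 := mul_le_mul_of_nonneg_left n2 (by linarith : 0 ≤ 1 - μ)
    have m3 := mul_le_mul_of_nonneg_left (hgG k) (mul_nonneg hμ.le hd0)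
    have m4 : μ * (s * G / (((k : ℝ) + 1) * (k + 2))) = μ * (s / (((k : ℝ) + 1) * (k + 2))) * G := by
      ring
    rw [m4]
    linarith
  -- combined induction
  have key := aux_key c μ s L DU ‖g y‖ Δ hc.le hc1 hμ hμ1 hs hL hDU0 (norm_nonneg _)
    (aux_low ℓ g L hL h2 M₀ hM y)
  set W := 2 * μ * s * Δ + 2 * (c * (μ * s * DU * G)) with hW
  have hW0 : 0 ≤ W := by positivity
  have ind : ∀ N : ℕ, ‖u (N + 1) - y‖ ^ 2 + c * ((N + 1 : ℝ) * ‖u (N + 1) - u N‖ ^ 2) ≤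
      DU ^ 2 + W * (harmonic (N + 1) : ℝ) := by
    intro N
    induction N with
    | zero =>
      have a := energy 0
      have b : ‖u 0 - y‖ ^ 2 ≤ DU ^ 2 := by gcongr; exact hDU _ hu0 _ hyU
      have d : 0 ≤ c * (μ * s * DU * G) := by positivity
      simp [harmonic] at a ⊢
      linarith
    | succ N ih =>
      have a := energy (N + 1)
      have r := recur N
      rw [harmonic_succ]
      push_cast at a ⊢
      have e2 : (N : ℝ) + 1 + 1 = N + 2 := by ring
      rw [e2] at a ⊢
      have hb1 := hDU _ (huU (N + 1)) _ (huU N)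
      have hb2 := hDU _ (huU (N + 2)) _ (huU (N + 1))
      have n1 := norm_nonneg (u (N + 1) - u N)
      have n2 := norm_nonneg (u (N + 2) - u (N + 1))
      set A := ‖u (N + 1) - u N‖
      set B := ‖u (N + 2) - u (N + 1)‖
      have he : 0 ≤ μ * (s * G / (((N : ℝ) + 1) * (N + 2))) := by positivity
      have sq : B ^ 2 ≤ A ^ 2 + 2 * DU * (μ * (s * G / (((N : ℝ) + 1) * (N + 2)))) := by
        set ε := μ * (s * G / (((N : ℝ) + 1) * (N + 2)))
        have : (B - A) * (B + A) ≤ ε * (2 * DU) := by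
          calc (B - A) * (B + A) ≤ ε * (B + A) :=
                mul_le_mul_of_nonneg_right (by linarith) (by linarith)
            _ ≤ _ := mul_le_mul_of_nonneg_left (by linarith) he
        nlinarith
      have sq2 : c * (((N : ℝ) + 1) * B ^ 2) ≤
          c * (((N : ℝ) + 1) * A ^ 2) + 2 * (c * (μ * s * DU * G)) * ((N : ℝ) + 2)⁻¹ := by
        calc c * (((N : ℝ) + 1) * B ^ 2)
            ≤ c * (((N : ℝ) + 1) * (A ^ 2 + 2 * DU * (μ * (s * G / (((N : ℝ) + 1) * (N + 2)))))) := by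
              gcongr
          _ = _ := by field_simp
      have e3 : 2 * μ * (s / ((N : ℝ) + 2)) * Δ = 2 * μ * s * Δ * ((N : ℝ) + 2)⁻¹ := by
        rw [div_eq_mul_inv]; ring
      rw [e3] at a
      have e4 : N + 1 + 1 = N + 2 := rfl
      rw [e4] at *
      rw [hW] at ih ⊢
      nlinarith
  have hh : (harmonic (N + 1) : ℝ) ≤ 1 + Real.log (N + 1 : ℕ) := harmonic_le_one_add_log (N + 1)
  have hlog : 0 ≤ Real.log (N + 1 : ℕ) := Real.log_natCast_nonneg _
  have f := ind N
  have f1 := mul_le_mul_of_nonneg_left hh hW0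
  have f2 : W ≤ 2 * DU ^ 2 + 3 * (2 * μ * s * Δ) := by rw [hW]; linarith
  have f3 := mul_le_mul_of_nonneg_right f2 (by linarith : 0 ≤ 1 + Real.log (N + 1 : ℕ))
  nlinarith [mul_nonneg (sq_nonneg DU) hlog, sq_nonneg ‖u (N + 1) - y‖]

end abstractPart

section concretePart
variable {E : Type*} [NormedAddCommGroup E] [InnerProductSpace ℝ E] [CompleteSpace E]

theorem aux_line (ℓ : E → ℝ) (hdiff : Differentiable ℝ ℓ) (x d : E) (t : ℝ) :
    HasDerivAt (fun t : ℝ => ℓ (x + t • d)) ⟪gradient ℓ (x + t • d), d⟫ t := by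
  have h1 : HasDerivAt (fun t : ℝ => x + t • d) d t := by
    have := ((hasDerivAt_id t).smul_const d).const_add x
    simpa using this
  have h2 := (hdiff (x + t • d)).hasFDerivAt.comp_hasDerivAt t h1
  rw [inner_gradient_left]
  exact h2

theorem aux_convex (ℓ : E → ℝ) (hconv : ConvexOn ℝ Set.univ ℓ) (hdiff : Differentiable ℝ ℓ)
    (x y : E) : ℓ x + ⟪gradient ℓ x, y - x⟫ ≤ ℓ y := by
  have hc : ConvexOn ℝ Set.univ (fun t : ℝ => ℓ (x + t • (y - x))) := by
    refine ⟨convex_univ, fun a _ b _ p q hp hq hpq => ?_⟩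
    have := hconv.2 (Set.mem_univ (x + a • (y - x))) (Set.mem_univ (x + b • (y - x))) hp hq hpq
    have e : x + (p • a + q • b) • (y - x) = p • (x + a • (y - x)) + q • (x + b • (y - x)) := by
      obtain rfl : q = 1 - p := by linarith
      simp only [smul_eq_mul]
      module
    simpa only [e] using this
  have hd := aux_line ℓ hdiff x (y - x) 0
  have := hc.le_slope_of_hasDerivAt (Set.mem_univ 0) (Set.mem_univ 1) one_pos hd
  simp [slope_def_field] at this
  rw [inner_gradient_left, map_sub]
  linarith

theorem aux_descent (ℓ : E → ℝ) (hdiff : Differentiable ℝ ℓ) (L : ℝ)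
    (hLip : ∀ u v, ‖gradient ℓ u - gradient ℓ v‖ ≤ L * ‖u - v‖)
    (x y : E) : ℓ y ≤ ℓ x + ⟪gradient ℓ x, y - x⟫ + L / 2 * ‖y - x‖ ^ 2 := by
  set d := y - x with hd
  let φ : ℝ → ℝ := fun t => ℓ (x + t • d) - t * ⟪gradient ℓ x, d⟫ - L / 2 * ‖d‖ ^ 2 * t ^ 2
  have hφ : ∀ t, HasDerivAt φ (⟪gradient ℓ (x + t • d), d⟫ - ⟪gradient ℓ x, d⟫
      - L / 2 * ‖d‖ ^ 2 * (2 * t)) t := fun t => by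
    have h1 := aux_line ℓ hdiff x d t
    have h2 := (hasDerivAt_id t).mul_const ⟪gradient ℓ x, d⟫
    have h3 := (hasDerivAt_pow 2 t).const_mul (L / 2 * ‖d‖ ^ 2)
    refine ((h1.sub h2).sub h3).congr_deriv ?_
    simp
  have hanti : AntitoneOn φ (Set.Icc 0 1) := by
    apply antitoneOn_of_deriv_nonpos (convex_Icc 0 1)
    · exact fun t _ => (hφ t).continuousAt.continuousWithinAt
    · exact fun t _ => (hφ t).differentiableAt.differentiableWithinAt
    · intro t ht
      rw [interior_Icc] at ht
      rw [(hφ t).deriv, ← inner_sub_left]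
      have a := real_inner_le_norm (gradient ℓ (x + t • d) - gradient ℓ x) d
      have b := hLip (x + t • d) x
      rw [add_sub_cancel_left, norm_smul, Real.norm_of_nonneg ht.1.le] at b
      have c := mul_le_mul_of_nonneg_right b (norm_nonneg d)
      nlinarith
  have := hanti (Set.left_mem_Icc.2 zero_le_one) (Set.right_mem_Icc.2 zero_le_one) zero_le_one
  have e : x + d = y := by rw [hd]; abel
  simp [φ, e] at this
  rw [inner_gradient_left]
  linarith

end concretePart

theorem aux_hIP_symm {n : ℕ} (H : Matrix (Fin n) (Fin n) ℝ) (hH : H.IsHermitian)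
    (x y : EuclideanSpace ℝ (Fin n)) : hIP H x y = hIP H y x := by
  have h := Matrix.isSymmetric_toEuclideanLin_iff.mpr hH
  unfold hIP
  rw [← h x y, real_inner_comm]

theorem aux_lambdaMin {n : ℕ} (H : Matrix (Fin n) (Fin n) ℝ) (hH : H.IsHermitian)
    (x : EuclideanSpace ℝ (Fin n)) : lambdaMin H hH * ‖x‖ ^ 2 ≤ hIP H x x := by
  have hs := Matrix.isSymmetric_toEuclideanLin_iff.mpr hH
  have hv : ∀ i, Matrix.toEuclideanLin H (hH.eigenvectorBasis i)
      = hH.eigenvalues i • hH.eigenvectorBasis i := fun i => by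
    have := hH.mulVec_eigenvectorBasis i
    apply PiLp.ext
    intro j
    simpa [Matrix.toEuclideanLin_apply] using congrFun this j
  have e : hIP H x x = ∑ i, hH.eigenvalues i * ⟪hH.eigenvectorBasis i, x⟫ ^ 2 := by
    unfold hIP
    rw [← hH.eigenvectorBasis.sum_inner_mul_inner]
    refine Finset.sum_congr rfl fun i _ => ?_
    rw [← hs, hv, inner_smul_left, real_inner_comm]
    simp; ring
  have e2 : ‖x‖ ^ 2 = ∑ i, ⟪hH.eigenvectorBasis i, x⟫ ^ 2 := by
    rw [← hH.eigenvectorBasis.sum_sq_norm_inner_right x]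
    simp
  rw [e, e2, Finset.mul_sum]
  refine Finset.sum_le_sum fun i _ => ?_
  gcongr
  exact ciInf_le (Set.finite_range _).bddBelow i

/-- The inner product core given by `hIP H`. -/
noncomputable def auxCore {n : ℕ} (H : Matrix (Fin n) (Fin n) ℝ) (hH : H.IsHermitian)
    (hl : 0 < lambdaMin H hH) :
    InnerProductSpace.Core ℝ (EuclideanSpace ℝ (Fin n)) where
  inner x y := hIP H x y
  conj_inner_symm x y := by simpa using aux_hIP_symm H hH y x
  re_inner_nonneg x := by
    have := aux_lambdaMin H hH x
    exact le_trans (by positivity) this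
  add_left x y z := by simp [hIP, inner_add_left]
  smul_left x y r := by simp [hIP, inner_smul_left]
  definite x hx := by
    have := aux_lambdaMin H hH x
    have hx' : hIP H x x = 0 := hx
    rw [hx'] at this
    have h0 : ‖x‖ ^ 2 = 0 := le_antisymm (by nlinarith) (sq_nonneg _)
    simpa using h0

theorem aux_inv {n : ℕ} (H : Matrix (Fin n) (Fin n) ℝ) (hH : H.PosDef)
    (x y : EuclideanSpace ℝ (Fin n)) : hIP H (Matrix.toEuclideanLin H⁻¹ x) y = ⟪x, y⟫ := by
  rw [aux_hIP_symm H hH.1]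
  unfold hIP
  have : Matrix.toEuclideanLin H (Matrix.toEuclideanLin H⁻¹ x) = x := by
    have hu : IsUnit H.det := (Matrix.isUnit_iff_isUnit_det H).1 hH.isUnit
    rw [Matrix.toEuclideanLin_apply, Matrix.toEuclideanLin_apply]
    simp [Matrix.mulVec_mulVec, Matrix.mul_nonsing_inv H hu]
  rw [this, real_inner_comm]

theorem aux_hNorm_sq {n : ℕ} (H : Matrix (Fin n) (Fin n) ℝ) (hH : H.IsHermitian)
    (hl : 0 < lambdaMin H hH) (x : EuclideanSpace ℝ (Fin n)) : hNorm H x ^ 2 = hIP H x x := by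
  unfold hNorm
  apply Real.sq_sqrt
  exact le_trans (by positivity) (aux_lambdaMin H hH x)

theorem aux_hNorm_cont {n : ℕ} (H : Matrix (Fin n) (Fin n) ℝ) : Continuous (hNorm H) := by
  unfold hNorm hIP
  have : Continuous (Matrix.toEuclideanLin H) := LinearMap.continuous_of_finiteDimensional _
  fun_prop

/-- rate estimate `‖u^n − u^{n−1}‖²_H ≤ C₁(1 + ln n)/n` for the
aggregated iteration, with the explicit constant `C₁` of the paper. -/
theorem stmt_9 {n : ℕ} (H : Matrix (Fin n) (Fin n) ℝ) (hH : H.PosDef)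
    (D : EuclideanSpace ℝ (Fin n) → EuclideanSpace ℝ (Fin n))
    (hD : ∀ u₁ u₂, hNorm H (D u₁ - D u₂) ≤ hNorm H (u₁ - u₂))
    (ℓ : EuclideanSpace ℝ (Fin n) → ℝ)
    (hconv : ConvexOn ℝ Set.univ ℓ) (hdiff : Differentiable ℝ ℓ)
    (L : ℝ) (hL : 0 < L)
    (hLip : ∀ u v, ‖gradient ℓ u - gradient ℓ v‖ ≤ L * ‖u - v‖)
    (M₀ : ℝ) (hM₀ : ∀ x, M₀ ≤ ℓ x)
    (α μ : ℝ) (hα : α ∈ Set.Ioo (0 : ℝ) 1) (hμ : μ ∈ Set.Ioo (0 : ℝ) 1)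
    (s : ℝ) (hs : s ∈ Set.Ioo 0 (lambdaMin H hH.1 / L))
    (U : Set (EuclideanSpace ℝ (Fin n)))
    (hUne : U.Nonempty) (hUcp : IsCompact U) (hUco : Convex ℝ U)
    (T : EuclideanSpace ℝ (Fin n) → EuclideanSpace ℝ (Fin n))
    (hT : ∀ u, T u = (1 - α) • u + α • D u)
    (hFix : ({y | T y = y} ∩ U).Nonempty)
    (lstar : ℝ) (hlstar : lstar = sInf (ℓ '' ({y | T y = y} ∩ U)))
    (DU M : ℝ)
    (hDU : DU = sSup ((fun p : EuclideanSpace ℝ (Fin n) × EuclideanSpace ℝ (Fin n) =>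
      hNorm H (p.1 - p.2)) '' (U ×ˢ U)))
    (hM : M = sSup ((fun x => ‖gradient ℓ x‖) '' U))
    (C₁ : ℝ)
    (hC₁ : C₁ = (3 * (DU ^ 2 + 2 * μ * s * (lstar - M₀))
        + 2 * μ * s * DU * M / lambdaMin H hH.1) /
      min (1 - s * L / lambdaMin H hH.1) (min ((1 - α) / α) 1))
    (u vl vu : ℕ → EuclideanSpace ℝ (Fin n))
    (hu0 : u 0 ∈ U)
    (hvl : ∀ k, vl (k + 1) = T (u k))
    (hvu : ∀ k, vu (k + 1) =
      u k - (s / ((k : ℝ) + 1)) • Matrix.toEuclideanLin H⁻¹ (gradient ℓ (u k)))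
    (hproj : ∀ k, u (k + 1) ∈ U ∧ ∀ w ∈ U,
      hNorm H (u (k + 1) - (μ • vu (k + 1) + (1 - μ) • vl (k + 1))) ≤
        hNorm H (w - (μ • vu (k + 1) + (1 - μ) • vl (k + 1)))) :
    ∀ N : ℕ, 1 ≤ N →
      hNorm H (u N - u (N - 1)) ^ 2 ≤ C₁ * (1 + Real.log N) / N := by
  have hl : 0 < lambdaMin H hH.1 := by
    have h := hs.1.trans hs.2
    by_contra hc
    exact absurd h (not_lt.2 (div_nonpos_of_nonpos_of_nonneg (not_lt.1 hc) hL.le))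
  set lam := lambdaMin H hH.1 with hlam
  have hsL : s * (L / lam) < 1 := by
    have := (lt_div_iff₀ hL).1 hs.2
    rw [← mul_div_assoc, div_lt_one hl]; exact this
  have hgc : Continuous (gradient ℓ) := by
    have : LipschitzWith L.toNNReal (gradient ℓ) := by
      refine LipschitzWith.of_dist_le_mul fun x y => ?_
      rw [dist_eq_norm, dist_eq_norm, Real.coe_toNNReal _ hL.le]
      exact hLip x y
    exact this.continuous
  have hbd : BddAbove ((fun p : EuclideanSpace ℝ (Fin n) × EuclideanSpace ℝ (Fin n) =>
      hNorm H (p.1 - p.2)) '' (U ×ˢ U)) :=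
    ((hUcp.prod hUcp).image ((aux_hNorm_cont H).comp
      (continuous_fst.sub continuous_snd))).bddAbove
  have hDU' : ∀ x ∈ U, ∀ x' ∈ U, hNorm H (x - x') ≤ DU := fun x hx x' hx' => by
    rw [hDU]
    exact le_csSup hbd ⟨(x, x'), ⟨hx, hx'⟩, rfl⟩
  have hDU0 : 0 ≤ DU := le_trans (Real.sqrt_nonneg _) (hDU' _ hu0 _ hu0)
  have hM0 : 0 ≤ M := by
    rw [hM]
    apply Real.sSup_nonneg
    rintro _ ⟨x, _, rfl⟩
    exact norm_nonneg _
  have h1 : ∀ x y, ℓ x + hIP H (Matrix.toEuclideanLin H⁻¹ (gradient ℓ x)) (y - x) ≤ ℓ y :=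
    fun x y => by
      rw [aux_inv H hH]; exact aux_convex ℓ hconv hdiff x y
  have h2 : ∀ x y, ℓ y ≤ ℓ x + hIP H (Matrix.toEuclideanLin H⁻¹ (gradient ℓ x)) (y - x)
      + (L / lam) / 2 * hNorm H (y - x) ^ 2 := fun x y => by
    rw [aux_inv H hH]
    have a := aux_descent ℓ hdiff L hLip x y
    have b := aux_lambdaMin H hH.1 (y - x)
    rw [← aux_hNorm_sq H hH.1 hl, ← hlam] at b
    have : L / 2 * ‖y - x‖ ^ 2 ≤ (L / lam) / 2 * hNorm H (y - x) ^ 2 := by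
      calc L / 2 * ‖y - x‖ ^ 2 = (L / lam) / 2 * (lam * ‖y - x‖ ^ 2) := by field_simp
        _ ≤ _ := by gcongr
    linarith
  set c := min (1 - s * L / lam) (min ((1 - α) / α) 1) with hcdef
  have hsL' : s * L / lam = s * (L / lam) := mul_div_assoc _ _ _
  have hc : 0 < c := by
    refine lt_min (by rw [hsL']; linarith) (lt_min (div_pos ?_ hα.1) one_pos)
    linarith [hα.2]
  have hc1 : c ≤ 1 - s * (L / lam) := by rw [← hsL']; exact min_le_left _ _
  have hc2 : c ≤ (1 - α) / α := (min_le_right _ _).trans (min_le_left _ _)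
  have core := fun (y : EuclideanSpace ℝ (Fin n)) (hyU : y ∈ U) (hy : T y = y) =>
    @aux_main (EuclideanSpace ℝ (Fin n)) (auxCore H hH.1 hl).toNormedAddCommGroup
      (InnerProductSpace.ofCore (auxCore H hH.1 hl).toCore) U hUco D hD T α hα.1 hα.2 hT ℓ
      (fun x => Matrix.toEuclideanLin H⁻¹ (gradient ℓ x)) (L / lam) (by positivity) h1 h2
      M₀ hM₀ μ s hμ.1 hμ.2 hs.1 hsL y hyU hy DU hDU' c hc hc1 hc2 u
      (fun k => μ • vu (k + 1) + (1 - μ) • vl (k + 1)) hu0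
      (fun k => by simp only [hvu, hvl]) hproj
  have core' : ∀ y ∈ U, T y = y → ∀ N : ℕ, c * ((N + 1 : ℝ) * hNorm H (u (N + 1) - u N) ^ 2) ≤
      3 * (DU ^ 2 + 2 * μ * s * (ℓ y - M₀)) * (1 + Real.log (N + 1 : ℕ)) := core
  intro N hN
  obtain ⟨K, rfl⟩ : ∃ K, N = K + 1 := ⟨N - 1, by omega⟩
  rw [Nat.add_sub_cancel]
  have hlog : 0 ≤ Real.log (K + 1 : ℕ) := Real.log_natCast_nonneg _
  have hpos : 0 < 3 * (2 * μ * s) * (1 + Real.log (K + 1 : ℕ)) := by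
    have := hμ.1; have := hs.1; positivity
  -- pass to the infimum
  have hinf : c * ((K + 1 : ℝ) * hNorm H (u (K + 1) - u K) ^ 2) ≤
      3 * (DU ^ 2 + 2 * μ * s * (lstar - M₀)) * (1 + Real.log (K + 1 : ℕ)) := by
    set A := c * ((K + 1 : ℝ) * hNorm H (u (K + 1) - u K) ^ 2) with hA
    set P := 3 * (2 * μ * s) * (1 + Real.log (K + 1 : ℕ)) with hP
    set Q := 3 * DU ^ 2 * (1 + Real.log (K + 1 : ℕ)) - P * M₀ with hQ
    have hlow : (A - Q) / P ≤ lstar := by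
      rw [hlstar]
      refine le_csInf (hFix.image ℓ) ?_
      rintro _ ⟨y, ⟨hy, hyU⟩, rfl⟩
      rw [div_le_iff₀ hpos]
      have := core' y hyU hy K
      rw [hQ, hP]
      linarith
    rw [div_le_iff₀ hpos] at hlow
    rw [hQ, hP] at hlow
    linarith
  have hextra : 0 ≤ 2 * μ * s * DU * M / lam * (1 + Real.log (K + 1 : ℕ)) := by
    have := hμ.1; have := hs.1; positivity
  rw [hC₁, div_mul_eq_mul_div, div_div, le_div_iff₀ (by positivity)]
  push_cast at *
  linarith
end
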